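/- There exists a constant c > 0 such that for every n ≥ 1, every family of unit vectors n₁,…,n_n on the unit sphere S² ⊆ ℝ³, and every weights α₁,…,α_n ≥ 0 with Σᵢ αᵢ = 1, the function f(x) = Σᵢ αᵢ·|⟨nᵢ, x⟩| on S² satisfies (∫_{S²} (f(x) − 1/2)² dσ(x))^{1/2} ≥ c·n^{−5/4}, where σ is the normalized (probability) surface measure on S². (Bourgain–Lindenstrauss–Milman L² lower bound for zonotope approximation of the ball in dimension 3.) -/

import Mathlib

open MeasureTheory
open scoped RealInnerProductSpace

/-- The rotation-invariant surface measure on the unit sphere `S² ⊆ ℝ³`, normalized to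
be a probability measure. -/
noncomputable def sphereProb :
    Measure (Metric.sphere (0 : EuclideanSpace ℝ (Fin 3)) 1) :=
  ((volume : Measure (EuclideanSpace ℝ (Fin 3))).toSphere Set.univ)⁻¹ •
    (volume : Measure (EuclideanSpace ℝ (Fin 3))).toSphere

noncomputable def Ff (t : ℝ) : ℝ := √(1 - t^2) + t * Real.arcsin t

noncomputable def bco (m : ℕ) : ℝ := Ring.choose ((1/2 : ℝ) + m - 1) m

lemma bco_zero : bco 0 = 1 := by simp [bco]

lemma bco_fact (m : ℕ) : (m.factorial : ℝ) * bco m = (ascPochhammer ℝ m).eval (1/2 : ℝ) := by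
  have h := Ring.factorial_nsmul_multichoose_eq_ascPochhammer (1/2 : ℝ) m
  rw [Polynomial.ascPochhammer_smeval_eq_eval] at h
  rw [← h, nsmul_eq_mul]
  congr 1
  unfold bco Ring.choose
  congr 1
  ring

lemma bco_succ (m : ℕ) : bco (m+1) = (m + 1/2) / (m+1) * bco m := by
  have h1 := bco_fact (m+1)
  have h0 := bco_fact m
  rw [ascPochhammer_succ_right] at h1
  simp only [Polynomial.eval_mul, Polynomial.eval_add, Polynomial.eval_X, Polynomial.eval_natCast] at h1
  rw [← h0, Nat.factorial_succ] at h1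
  push_cast at h1
  have hf : (m.factorial : ℝ) ≠ 0 := by positivity
  have hm : (m : ℝ) + 1 ≠ 0 := by positivity
  field_simp
  apply mul_left_cancel₀ hf
  linarith

lemma bco_pos (m : ℕ) : 0 < bco m := by
  induction m with
  | zero => simp [bco_zero]
  | succ k ih => rw [bco_succ]; positivity

lemma bco_le (m : ℕ) : bco m ≤ 1 := by
  induction m with
  | zero => simp [bco_zero]
  | succ k ih =>
    rw [bco_succ]
    have : ((k:ℝ) + 1/2) / (k+1) ≤ 1 := by
      rw [div_le_one (by positivity)]; linarith
    have h2 := bco_pos k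
    nlinarith

lemma bco_sq (m : ℕ) : 1 ≤ 4 * ((m:ℝ)+1) * bco (m+1) ^ 2 := by
  induction m with
  | zero => rw [bco_succ]; norm_num [bco_zero]
  | succ k ih =>
    rw [bco_succ (k+1), mul_pow]
    push_cast
    have h1 : ((k:ℝ)+1) ≤ ((k:ℝ)+1+1) * (((k:ℝ)+1+1/2)/(k+1+1))^2 := by
      rw [div_pow, mul_div_assoc', le_div_iff₀ (by positivity)]
      have : (0:ℝ) ≤ k := by positivity
      nlinarith
    have h2 : 0 ≤ bco (k+1)^2 := by positivity
    nlinarith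

lemma hasSum_invsqrt {t : ℝ} (ht : |t| < 1) :
    HasSum (fun m => bco m * t ^ (2*m)) (1 / √(1 - t^2)) := by
  have h := Real.one_div_one_sub_rpow_hasFPowerSeriesOnBall_zero (1/2 : ℝ)
  have hm : t^2 ∈ Metric.eball (0:ℝ) 1 := by
    rw [← ENNReal.ofReal_one, Metric.eball_ofReal]
    simp
    exact ht
  have := h.hasSum hm
  simp only [FormalMultilinearSeries.ofScalars_apply_eq, zero_add, smul_eq_mul] at this
  rw [Real.sqrt_eq_rpow]
  simp only [bco, pow_mul]
  exact this

lemma hasSum_integ (c : ℕ → ℝ) (e : ℕ → ℕ) (he : ∀ m, m ≤ e m) (hc : ∀ m, |c m| ≤ 1)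
    (f : ℝ → ℝ) (hf : ∀ t, |t| < 1 → HasSum (fun m => c m * t ^ (e m)) (f t)) {t : ℝ} (ht : |t| < 1) :
    HasSum (fun m => c m / (e m + 1) * t ^ (e m + 1)) (∫ u in (0:ℝ)..t, f u) := by
  have key := intervalIntegral.hasSum_intervalIntegral_of_summable_norm (a := 0) (b := t)
    (f := fun m => (⟨fun u => c m * u ^ (e m), by fun_prop⟩ : C(ℝ, ℝ))) ?_
  · have : ∫ u in (0:ℝ)..t, f u = ∫ u in (0:ℝ)..t, ∑' m, c m * u ^ (e m) := by
      apply intervalIntegral.integral_congr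
      intro u hu
      refine (hf u ?_).tsum_eq.symm
      have := Set.abs_sub_left_of_mem_uIcc hu
      simp at this
      linarith
    rw [this]
    have e1 : (fun m => c m / (e m + 1) * t ^ (e m + 1)) =
        fun m => ∫ u in (0:ℝ)..t, c m * u ^ (e m) := by
      funext m
      simp
      ring
    rw [e1]
    exact key
  · refine Summable.of_nonneg_of_le (fun _ => norm_nonneg _) (fun m => ?_)
      (summable_geometric_of_lt_one (abs_nonneg t) ht)
    rw [ContinuousMap.norm_le _ (by positivity)]
    rintro ⟨u, hu⟩
    simp
    have := Set.abs_sub_left_of_mem_uIcc (show u ∈ Set.uIcc 0 t from hu)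
    simp at this
    calc |c m| * |u| ^ e m ≤ 1 * |t| ^ e m := by gcongr; exact hc m
      _ ≤ |t| ^ m := by rw [one_mul]; exact pow_le_pow_of_le_one (abs_nonneg _) ht.le (he m)


noncomputable def dco (m : ℕ) : ℝ := bco m / ((2*m+1) * (2*m+2))

lemma integ_arcsin {t : ℝ} (ht : |t| < 1) : ∫ u in (0:ℝ)..t, 1 / √(1 - u^2) = Real.arcsin t := by
  have hu : ∀ u ∈ Set.uIcc 0 t, -1 < u ∧ u < 1 := by
    intro u hu
    have := Set.abs_sub_left_of_mem_uIcc hu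
    simp at this
    exact abs_lt.mp (by linarith)
  rw [intervalIntegral.integral_eq_sub_of_hasDerivAt (f := Real.arcsin)]
  · simp
  · intro u h
    exact Real.hasDerivAt_arcsin (by linarith [(hu u h).1]) (by linarith [(hu u h).2])
  · apply ContinuousOn.intervalIntegrable
    apply ContinuousOn.div (by fun_prop) (by fun_prop)
    intro u h
    have := hu u h
    exact (Real.sqrt_pos.mpr (by nlinarith)).ne'

lemma integ_Ff {t : ℝ} (ht : |t| < 1) : ∫ u in (0:ℝ)..t, Real.arcsin u = Ff t - 1 := by
  have hu : ∀ u ∈ Set.uIcc 0 t, -1 < u ∧ u < 1 := by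
    intro u hu
    have := Set.abs_sub_left_of_mem_uIcc hu
    simp at this
    exact abs_lt.mp (by linarith)
  rw [intervalIntegral.integral_eq_sub_of_hasDerivAt (f := Ff)]
  · simp [Ff]
  · intro u h
    have h1 := hu u h
    have hp : 0 < 1 - u^2 := by nlinarith
    have ha := Real.hasDerivAt_arcsin (x := u) (by linarith) (by linarith)
    have hs := ((((hasDerivAt_id u).pow 2).const_sub 1).sqrt hp.ne')
    have := hs.add ((hasDerivAt_id u).mul ha)
    have h3 := Real.sqrt_pos.mpr hp
    refine HasDerivAt.congr_deriv (f' := _) this ?_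
    simp only [id, Pi.pow_apply]
    push_cast
    field_simp
    ring
  · exact Real.continuous_arcsin.intervalIntegrable _ _

lemma dco_pos (m : ℕ) : 0 < dco m := by
  have := bco_pos m
  unfold dco; positivity

lemma summable_dco : Summable dco := by
  have h : Summable (fun m : ℕ => 1 / ((m+1 : ℕ) : ℝ) ^ 2) := 
    (summable_nat_add_iff 1).mpr (Real.summable_one_div_nat_pow.mpr one_lt_two)
  refine Summable.of_nonneg_of_le (fun m => (dco_pos m).le) (fun m => ?_) h
  unfold dco
  push_cast
  have := bco_le m
  gcongr
  have : (0:ℝ) ≤ m := by positivity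
  nlinarith

lemma hasSum_Ff {t : ℝ} (ht : |t| ≤ 1) :
    HasSum (fun m => dco m * t ^ (2*m+2)) (Ff t - 1) := by
  have h1 : ∀ t : ℝ, |t| < 1 → HasSum (fun m => dco m * t ^ (2*m+2)) (Ff t - 1) := by
    intro t ht
    have h2 : ∀ t : ℝ, |t| < 1 → HasSum (fun m => bco m / (((2*m:ℕ):ℝ)+1) * t ^ (2*m+1)) (Real.arcsin t) := by
      intro t ht
      rw [← integ_arcsin ht]
      exact hasSum_integ bco (fun m => 2*m) (fun m => by lia) 
        (fun m => by rw [abs_of_pos (bco_pos m)]; exact bco_le m) _ (fun t ht => hasSum_invsqrt ht) ht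
    rw [← integ_Ff ht]
    have := hasSum_integ _ _ (fun m => by lia) ?_ _ h2 ht
    · have e1 : (fun m => dco m * t ^ (2*m+2)) = fun m => bco m / (((2*m:ℕ):ℝ)+1) /
          (((2*m+1:ℕ):ℝ)+1) * t ^ (2*m+1+1) := by
        funext m
        unfold dco
        push_cast
        field_simp
        ring
      rw [e1]
      exact this
    · intro m
      have := bco_pos m
      rw [abs_of_pos (by positivity), div_le_one (by positivity)]
      have := bco_le m
      push_cast
      have : (0:ℝ) ≤ m := by positivity
      linarith
  have hb : ∀ m, ∀ t ∈ Set.Icc (-1:ℝ) 1, ‖dco m * t ^ (2*m+2)‖ ≤ dco m := by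
    intro m t ht
    rw [norm_mul, norm_pow, Real.norm_of_nonneg (dco_pos m).le]
    exact mul_le_of_le_one_right (dco_pos m).le (pow_le_one₀ (norm_nonneg _) (abs_le.mpr ht))
  have hsum : ContinuousOn (fun t : ℝ => ∑' m, dco m * t ^ (2*m+2)) (Set.Icc (-1) 1) :=
    continuousOn_tsum (fun m => by fun_prop) summable_dco hb
  have hF : Continuous (fun t => Ff t - 1) := by
    unfold Ff; have := Real.continuous_arcsin; fun_prop
  have heq : Set.EqOn (fun t : ℝ => ∑' m, dco m * t ^ (2*m+2)) (fun t => Ff t - 1) (Set.Icc (-1) 1) := by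
    refine Set.EqOn.of_subset_closure (s := Set.Ioo (-1) 1) ?_ hsum hF.continuousOn Set.Ioo_subset_Icc_self ?_
    · intro t ht
      exact (h1 t (abs_lt.mpr ht)).tsum_eq
    · rw [closure_Ioo (by norm_num)]
  have ht' := abs_le.mp ht
  rw [show Ff t - 1 = _ from (heq ht').symm]
  exact (Summable.of_norm_bounded summable_dco (fun m => hb m t ht')).hasSum


lemma gauss_radial (k : ℕ) : ∫ r in Set.Ioi (0:ℝ), r ^ k * Real.exp (-r^2)
    = 1/2 * Real.Gamma ((k+1)/2) := by
  have := integral_rpow_mul_exp_neg_rpow (p := 2) (q := k) (by norm_num)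
    (by have : (0:ℝ) ≤ k := by positivity
        linarith)
  simpa using this

lemma gauss_line (k : ℕ) : ∫ r : ℝ, |r| ^ k * Real.exp (-r^2) = Real.Gamma ((k+1)/2) := by
  have := integral_comp_abs (f := fun r : ℝ => r ^ k * Real.exp (-r^2))
  simp only [sq_abs] at this
  rw [this, gauss_radial]; ring

lemma polar_hom (g : EuclideanSpace ℝ (Fin 3) → ℝ) (k : ℕ)
    (hg : ∀ r : ℝ, 0 < r → ∀ x, g (r • x) = r ^ k * g x) :
    ∫ x, g x * Real.exp (-‖x‖^2) =
      (∫ x : Metric.sphere (0 : EuclideanSpace ℝ (Fin 3)) 1, g x ∂(volume : Measure (EuclideanSpace ℝ (Fin 3))).toSphere)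
        * (1/2 * Real.Gamma ((k+3)/2)) := by
  set μ : Measure (EuclideanSpace ℝ (Fin 3)) := volume
  have hdim : Module.finrank ℝ (EuclideanSpace ℝ (Fin 3)) - 1 = 2 := by simp
  calc ∫ x, g x * Real.exp (-‖x‖^2) ∂μ 
      = ∫ x : ({(0)}ᶜ : Set (EuclideanSpace ℝ (Fin 3))), g x.1 * Real.exp (-‖x.1‖^2) ∂(μ.comap (↑)) := by
        rw [integral_subtype_comap (measurableSet_singleton _).compl fun x ↦ g x * Real.exp (-‖x‖^2),
          restrict_compl_singleton]
    _ = ∫ x, g x.1 * (x.2.1 ^ k * Real.exp (-x.2.1^2)) ∂μ.toSphere.prod (.volumeIoiPow (Module.finrank ℝ (EuclideanSpace ℝ (Fin 3)) - 1)) := by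
        rw [← μ.measurePreserving_homeomorphUnitSphereProd.integral_comp
          (Homeomorph.measurableEmbedding _)]
        apply integral_congr_ae
        filter_upwards with x
        have hx : 0 < ‖x.1‖ := norm_pos_iff.mpr x.2
        simp only [homeomorphUnitSphereProd_apply_snd_coe, homeomorphUnitSphereProd_apply_fst_coe]
        rw [← mul_assoc, mul_comm _ (‖x.1‖ ^ k), ← hg _ hx, smul_smul, mul_inv_cancel₀ hx.ne', one_smul]
    _ = (∫ x, g x.1 ∂μ.toSphere) * ∫ r : Set.Ioi (0:ℝ), r.1 ^ k * Real.exp (-r.1^2) ∂.volumeIoiPow (Module.finrank ℝ (EuclideanSpace ℝ (Fin 3)) - 1) :=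
        integral_prod_mul (fun x : Metric.sphere (0 : EuclideanSpace ℝ (Fin 3)) 1 => g x.1)
          (fun r : Set.Ioi (0:ℝ) => r.1 ^ k * Real.exp (-r.1^2))
    _ = _ := by
      rw [hdim]
      congr 1
      have h2 := gauss_radial (k+2)
      push_cast at h2
      rw [show (k:ℝ)+3 = k+2+1 by ring, ← h2]
      simp only [Measure.volumeIoiPow, ENNReal.ofReal]
      rw [integral_withDensity_eq_integral_smul,
        integral_subtype_comap measurableSet_Ioi fun a ↦ Real.toNNReal (a ^ 2) • (a ^ k * Real.exp (-a^2)),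
        setIntegral_congr_fun measurableSet_Ioi fun x hx ↦ ?_]
      · simp only [NNReal.smul_def]
        rw [Real.coe_toNNReal _ (sq_nonneg _), smul_eq_mul]; ring
      · exact (measurable_subtype_coe.pow_const _).real_toNNReal

/-- coordinates in an orthonormal basis -/
lemma integral_coords (b : OrthonormalBasis (Fin 3) ℝ (EuclideanSpace ℝ (Fin 3)))
    (g : (Fin 3 → ℝ) → ℝ) :
    ∫ x : EuclideanSpace ℝ (Fin 3), g (fun i => ⟪b i, x⟫) * Real.exp (-‖x‖^2) =
      ∫ y : Fin 3 → ℝ, g y * Real.exp (-(y 0 ^2 + y 1 ^2 + y 2 ^2)) := by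
  have h := b.measurePreserving_repr_symm.comp (PiLp.volume_preserving_toLp (Fin 3))
  rw [← h.integral_comp (b.repr.symm.toHomeomorph.measurableEmbedding.comp 
    (MeasurableEquiv.toLp 2 (Fin 3 → ℝ)).measurableEmbedding)]
  apply integral_congr_ae
  filter_upwards with y
  have h1 : ∀ i, ⟪b i, b.repr.symm (WithLp.toLp 2 y)⟫ = y i := by
    intro i
    rw [← b.repr_apply_apply]; simp
  have h2 : ‖b.repr.symm (WithLp.toLp 2 y)‖^2 = y 0 ^2 + y 1 ^2 + y 2 ^2 := by
    rw [LinearIsometryEquiv.norm_map, EuclideanSpace.norm_sq_eq]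
    simp [Fin.sum_univ_three]
  simp only [Function.comp, h1, h2]

lemma exists_basis (n m : EuclideanSpace ℝ (Fin 3)) (hn : ‖n‖ = 1) (hm : ‖m‖ = 1) :
    ∃ (b : OrthonormalBasis (Fin 3) ℝ (EuclideanSpace ℝ (Fin 3))) (a t s : ℝ), |a| = 1 ∧
      t^2+s^2 = 1 ∧ ⟪n, m⟫ = a * t ∧ (∀ x, ⟪n, x⟫ = a * ⟪b 0, x⟫) ∧
      ∀ x, ⟪m, x⟫ = t * ⟪b 0, x⟫ + s * ⟪b 1, x⟫ := by
  set f : Fin 3 → EuclideanSpace ℝ (Fin 3) := ![n, m, 0] with hf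
  have hd : Module.finrank ℝ (EuclideanSpace ℝ (Fin 3)) = Fintype.card (Fin 3) := by simp
  set b := InnerProductSpace.gramSchmidtOrthonormalBasis hd f with hb
  have h10 : ⟪b 1, n⟫ = 0 := InnerProductSpace.gramSchmidtOrthonormalBasis_inv_triangular hd f (i := 0) (j := 1) (by decide)
  have h20 : ⟪b 2, n⟫ = 0 := InnerProductSpace.gramSchmidtOrthonormalBasis_inv_triangular hd f (i := 0) (j := 2) (by decide)
  have h21 : ⟪b 2, m⟫ = 0 := InnerProductSpace.gramSchmidtOrthonormalBasis_inv_triangular hd f (i := 1) (j := 2) (by decide)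
  have key : ∀ x y : EuclideanSpace ℝ (Fin 3), ⟪x, y⟫ = ⟪b 0, x⟫ * ⟪b 0, y⟫ + ⟪b 1, x⟫ * ⟪b 1, y⟫ + ⟪b 2, x⟫ * ⟪b 2, y⟫ := by
    intro x y
    rw [← b.sum_inner_mul_inner x y, Fin.sum_univ_three]
    simp only [real_inner_comm x]
  refine ⟨b, ⟪b 0, n⟫, ⟪b 0, m⟫, ⟪b 1, m⟫, ?_, ?_, ?_, ?_, ?_⟩
  · have := key n n
    rw [real_inner_self_eq_norm_sq, hn, h10, h20] at this
    have h2 : ⟪b 0, n⟫ ^ 2 = 1 := by linarith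
    rw [← Real.sqrt_sq_eq_abs, h2, Real.sqrt_one]
  · have := key m m
    rw [real_inner_self_eq_norm_sq, hm, h21] at this
    linarith
  · rw [key n m, h10, h20]; ring
  · intro x; rw [key n x, h10, h20]; ring
  · intro x; rw [key m x, h21]; ring


lemma int3 (G : ℝ × ℝ → ℝ) :
    ∫ y : Fin 3 → ℝ, G (y 0, y 1) * Real.exp (-(y 0 ^2 + y 1 ^2 + y 2 ^2)) =
      Real.Gamma (1/2) * ∫ p : ℝ × ℝ, G p * Real.exp (-(p.1^2+p.2^2)) := by
  have h1 := volume_preserving_piFinSuccAbove (fun _ : Fin 3 => ℝ) 2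
  have h2 := volume_preserving_finTwoArrow ℝ
  have h0 := gauss_line 0
  simp only [pow_zero, one_mul, Nat.cast_zero, zero_add] at h0
  rw [← h2.integral_comp (MeasurableEquiv.measurableEmbedding _), ← h0,
    ← integral_prod_mul (fun r : ℝ => Real.exp (-r^2))
      (fun y : Fin 2 → ℝ => G (MeasurableEquiv.finTwoArrow y) *
        Real.exp (-((MeasurableEquiv.finTwoArrow y).1^2+(MeasurableEquiv.finTwoArrow y).2^2)))]
  refine Eq.trans ?_ (h1.integral_comp (MeasurableEquiv.measurableEmbedding _) _)
  apply integral_congr_ae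
  filter_upwards with y
  have e0 : (MeasurableEquiv.piFinSuccAbove (fun _ : Fin 3 => ℝ) 2 y).2 0 = y 0 := rfl
  have e1 : (MeasurableEquiv.piFinSuccAbove (fun _ : Fin 3 => ℝ) 2 y).2 1 = y 1 := rfl
  have e2 : (MeasurableEquiv.piFinSuccAbove (fun _ : Fin 3 => ℝ) 2 y).1 = y 2 := rfl
  have e3 : ∀ z : Fin 2 → ℝ, MeasurableEquiv.finTwoArrow z = (z 0, z 1) := fun z => rfl
  simp only [e3, e0, e1, e2]
  rw [show -(y 0 ^2 + y 1 ^2 + y 2 ^2) = -(y 2 ^2) + -(y 0 ^2 + y 1^2) by ring, Real.exp_add]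
  ring

lemma int2 (k : ℕ) : ∫ p : ℝ × ℝ, |p.1| ^ k * Real.exp (-(p.1^2+p.2^2)) =
    Real.Gamma ((k+1)/2) * Real.Gamma (1/2) := by
  have h0 := gauss_line 0
  simp only [pow_zero, one_mul, Nat.cast_zero, zero_add] at h0
  rw [← gauss_line k, ← h0, ← integral_prod_mul]
  apply integral_congr_ae
  filter_upwards with p
  rw [neg_add, Real.exp_add]; ring

lemma toSphere_total : (volume : Measure (EuclideanSpace ℝ (Fin 3))).toSphere.real Set.univ =
    4 * Real.pi := by
  have h := polar_hom (fun _ => 1) 0 (by simp)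
  have h2 := integral_coords (EuclideanSpace.basisFun (Fin 3) ℝ) (fun _ => 1)
  have h3 := int3 (fun _ => 1)
  have h4 := int2 0
  simp only [pow_zero] at h4
  rw [h2, h3, h4] at h
  simp only [integral_const, smul_eq_mul, mul_one, Nat.cast_zero, zero_add] at h
  have g3 : Real.Gamma (3/2) = 1/2 * Real.Gamma (1/2) := by
    rw [show (3/2:ℝ) = 1/2 + 1 by norm_num, Real.Gamma_add_one (by norm_num)]
  rw [g3, Real.Gamma_one_half_eq] at h
  have hs : √Real.pi > 0 := Real.sqrt_pos.mpr Real.pi_pos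
  have hq : √Real.pi * √Real.pi = Real.pi := Real.mul_self_sqrt Real.pi_pos.le
  rw [hq] at h
  apply mul_right_cancel₀ hs.ne'
  linarith

instance : IsProbabilityMeasure sphereProb := by
  refine ⟨?_⟩
  have h := toSphere_total
  unfold sphereProb
  rw [Measure.smul_apply, smul_eq_mul, ENNReal.inv_mul_cancel]
  · intro h0
    rw [Measure.real, h0] at h
    simp at h
  · exact measure_ne_top _ _

lemma integral_sphereProb (g : EuclideanSpace ℝ (Fin 3) → ℝ) (k : ℕ)
    (hg : ∀ r : ℝ, 0 < r → ∀ x, g (r • x) = r ^ k * g x) :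
    (∫ x : Metric.sphere (0 : EuclideanSpace ℝ (Fin 3)) 1, g x ∂sphereProb) 
       * (2 * Real.pi * Real.Gamma ((k+3)/2)) = ∫ x, g x * Real.exp (-‖x‖^2) := by
  rw [polar_hom g k hg]
  unfold sphereProb
  rw [integral_smul_measure, ENNReal.toReal_inv]
  have h := toSphere_total
  unfold Measure.real at h
  rw [h, smul_eq_mul]
  have := Real.pi_pos
  field_simp
  ring

lemma moment (n : EuclideanSpace ℝ (Fin 3)) (hn : ‖n‖ = 1) (k : ℕ) :
    ∫ x : Metric.sphere (0 : EuclideanSpace ℝ (Fin 3)) 1, |⟪n, (x : EuclideanSpace ℝ (Fin 3))⟫| ^ k ∂sphereProb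
      = 1 / (k+1) := by
  obtain ⟨b, a, t, s, ha, -, -, h1, -⟩ := exists_basis n n hn hn
  have h := integral_sphereProb (fun x => |⟪n, x⟫| ^ k) k (by
    intro r hr x
    rw [inner_smul_right, abs_mul, abs_of_pos hr, mul_pow])
  have h2 := integral_coords b (fun y => |y 0| ^ k)
  have h3 := int3 (fun p => |p.1| ^ k)
  simp only [h1, abs_mul, ha, one_mul] at h ⊢
  rw [h2, h3, int2, show ((k:ℝ)+3)/2 = (k+1)/2 + 1 by ring, Real.Gamma_add_one (by positivity),
    Real.Gamma_one_half_eq] at h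
  have hq : √Real.pi * √Real.pi = Real.pi := Real.mul_self_sqrt Real.pi_pos.le
  have hp := Real.pi_pos
  have hG : 0 < Real.Gamma (((k:ℝ)+1)/2) := Real.Gamma_pos_of_pos (by positivity)
  rw [eq_div_iff (by positivity)]
  apply mul_right_cancel₀ (mul_pos hp hG).ne'
  calc _ = _ := by ring
    _ = _ := h
    _ = (√Real.pi * √Real.pi) * Real.Gamma (((k:ℝ)+1)/2) := by ring
    _ = _ := by rw [hq, one_mul]



lemma Ff_neg (t : ℝ) : Ff (-t) = Ff t := by simp [Ff]

lemma ang_cont (θ : ℝ) : Continuous (fun φ => |Real.cos φ| * |Real.cos (φ - θ)|) := by fun_prop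

lemma ang_half (θ : ℝ) (h0 : 0 ≤ θ) (h1 : θ ≤ Real.pi) :
    ∫ φ in (-(Real.pi/2))..(Real.pi/2), |Real.cos φ| * |Real.cos (φ - θ)| =
      Real.sin θ + (Real.pi/2 - θ) * Real.cos θ := by
  have hd : ∀ φ : ℝ, HasDerivAt (fun φ => 1/2 * φ * Real.cos θ + 1/4 * Real.sin (2*φ - θ))
      (Real.cos φ * Real.cos (φ - θ)) φ := by
    intro φ
    have h2 : HasDerivAt (fun φ : ℝ => 2*φ - θ) 2 φ := by
      simpa using ((hasDerivAt_id φ).const_mul 2).sub_const θ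
    have h3 : HasDerivAt (fun φ : ℝ => 1/2 * φ * Real.cos θ) (1/2 * Real.cos θ) φ := by
      exact (((hasDerivAt_id φ).const_mul (1/2)).mul_const (Real.cos θ)).congr_deriv (by ring)
    refine (h3.add (h2.sin.const_mul (1/4))).congr_deriv ?_
    have e1 := Real.cos_add φ (φ - θ)
    have e2 := Real.cos_sub φ (φ - θ)
    rw [show φ - (φ - θ) = θ by ring] at e2
    rw [show φ + (φ - θ) = 2*φ - θ by ring] at e1
    rw [e1, e2]; ring
  have hF := fun a b : ℝ => intervalIntegral.integral_eq_sub_of_hasDerivAt (a := a) (b := b)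
    (fun φ _ => hd φ) ((by fun_prop : Continuous (fun φ => Real.cos φ * Real.cos (φ - θ))).intervalIntegrable _ _)
  rw [← intervalIntegral.integral_add_adjacent_intervals (b := θ - Real.pi/2)
    ((ang_cont θ).intervalIntegrable _ _) ((ang_cont θ).intervalIntegrable _ _)]
  have i1 : ∫ φ in (-(Real.pi/2))..(θ - Real.pi/2), |Real.cos φ| * |Real.cos (φ - θ)| =
      ∫ φ in (-(Real.pi/2))..(θ - Real.pi/2), -(Real.cos φ * Real.cos (φ - θ)) := by
    apply intervalIntegral.integral_congr
    intro φ hφ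
    rw [Set.uIcc_of_le (by linarith)] at hφ
    have c1 : 0 ≤ Real.cos φ := Real.cos_nonneg_of_mem_Icc ⟨by linarith [hφ.1], by linarith [hφ.2]⟩
    have c2 : Real.cos (φ - θ) ≤ 0 := by
      rw [← Real.cos_neg]
      exact Real.cos_nonpos_of_pi_div_two_le_of_le (by linarith [hφ.2]) (by linarith [hφ.1])
    simp only
    rw [abs_of_nonneg c1, abs_of_nonpos c2]; ring
  have i2 : ∫ φ in (θ - Real.pi/2)..(Real.pi/2), |Real.cos φ| * |Real.cos (φ - θ)| =
      ∫ φ in (θ - Real.pi/2)..(Real.pi/2), (Real.cos φ * Real.cos (φ - θ)) := by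
    apply intervalIntegral.integral_congr
    intro φ hφ
    rw [Set.uIcc_of_le (by linarith)] at hφ
    have c1 : 0 ≤ Real.cos φ := Real.cos_nonneg_of_mem_Icc ⟨by linarith [hφ.1], by linarith [hφ.2]⟩
    have c2 : 0 ≤ Real.cos (φ - θ) := Real.cos_nonneg_of_mem_Icc ⟨by linarith [hφ.1], by linarith [hφ.2]⟩
    simp only
    rw [abs_of_nonneg c1, abs_of_nonneg c2]
  rw [i1, i2, intervalIntegral.integral_neg, hF, hF]
  rw [show 2 * (Real.pi/2) - θ = Real.pi - θ by ring, Real.sin_pi_sub,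
    show 2 * (θ - Real.pi/2) - θ = θ - Real.pi by ring, Real.sin_sub_pi,
    show 2 * (-(Real.pi/2)) - θ = -(θ + Real.pi) by ring, Real.sin_neg, Real.sin_add_pi]
  ring

lemma ang_full (θ : ℝ) (h0 : 0 ≤ θ) (h1 : θ ≤ Real.pi) :
    ∫ φ in (-Real.pi)..Real.pi, |Real.cos φ| * |Real.cos (φ - θ)| = 2 * Ff (Real.cos θ) := by
  have hper : Function.Periodic (fun φ => |Real.cos φ| * |Real.cos (φ - θ)|) Real.pi := by
    intro φ
    simp only
    rw [show φ + Real.pi - θ = (φ - θ) + Real.pi by ring, Real.cos_add_pi, Real.cos_add_pi, abs_neg, abs_neg]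
  rw [← intervalIntegral.integral_add_adjacent_intervals (b := 0)
    ((ang_cont θ).intervalIntegrable _ _) ((ang_cont θ).intervalIntegrable _ _)]
  have e1 := hper.intervalIntegral_add_eq (-Real.pi) (-(Real.pi/2))
  have e2 := hper.intervalIntegral_add_eq 0 (-(Real.pi/2))
  rw [show -Real.pi + Real.pi = 0 by ring] at e1
  rw [zero_add] at e2
  rw [e1, e2, show -(Real.pi/2) + Real.pi = Real.pi/2 by ring, ang_half θ h0 h1]
  unfold Ff
  rw [Real.arcsin_eq_pi_div_two_sub_arccos, Real.arccos_cos h0 h1, ← Real.abs_sin_eq_sqrt_one_sub_cos_sq,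
    abs_of_nonneg (Real.sin_nonneg_of_nonneg_of_le_pi h0 h1)]
  ring

lemma ang_full' (t s : ℝ) (h : t^2 + s^2 = 1) :
    ∫ φ in (-Real.pi)..Real.pi, |Real.cos φ| * |t * Real.cos φ + s * Real.sin φ| = 2 * Ff t := by
  have ht : -1 ≤ t ∧ t ≤ 1 := abs_le.mp ((sq_le_one_iff_abs_le_one t).mp (by nlinarith [sq_nonneg s]))
  have hc : Real.cos (Real.arccos t) = t := Real.cos_arccos ht.1 ht.2
  have hs : Real.sin (Real.arccos t) = |s| := by
    rw [Real.sin_arccos, show 1 - t^2 = s^2 by linarith, Real.sqrt_sq_eq_abs]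
  have key := ang_full (Real.arccos t) (Real.arccos_nonneg t) (Real.arccos_le_pi t)
  simp only [Real.cos_sub, hc, hs] at key
  rcases abs_cases s with ⟨h1, -⟩ | ⟨h1, -⟩
  · rw [h1] at key
    rw [← key]
    apply intervalIntegral.integral_congr
    intro φ _
    simp only [mul_comm]
  · rw [h1] at key
    rw [← key]
    rw [← neg_neg Real.pi, ← intervalIntegral.integral_comp_neg, neg_neg]
    apply intervalIntegral.integral_congr
    intro φ _
    simp only [Real.cos_neg, Real.sin_neg]
    congr 2
    ring

lemma int2_polar (t s : ℝ) (h : t^2 + s^2 = 1) :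
    ∫ p : ℝ × ℝ, |p.1| * |t * p.1 + s * p.2| * Real.exp (-(p.1^2+p.2^2)) = Ff t := by
  rw [← integral_comp_polarCoord_symm]
  have hr := gauss_radial 3
  rw [show (((3:ℕ):ℝ)+1)/2 = 2 by norm_num, Real.Gamma_two] at hr
  have ha := ang_full' t s h
  rw [intervalIntegral.integral_of_le (by linarith [Real.pi_pos]), integral_Ioc_eq_integral_Ioo] at ha
  have := setIntegral_prod_mul (μ := volume) (ν := volume) (fun r : ℝ => r^3 * Real.exp (-r^2))
    (fun φ => |Real.cos φ| * |t * Real.cos φ + s * Real.sin φ|) (Set.Ioi 0) (Set.Ioo (-Real.pi) Real.pi)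
  rw [hr, ha] at this
  rw [show Ff t = 1/2*1*(2 * Ff t) by ring, ← this, polarCoord_target]
  apply setIntegral_congr_fun (measurableSet_Ioi.prod measurableSet_Ioo)
  rintro ⟨r, φ⟩ ⟨hr0, -⟩
  have hr0 : 0 < r := hr0
  simp only [polarCoord_symm_apply, smul_eq_mul]
  rw [show t * (r * Real.cos φ) + s * (r * Real.sin φ) = r * (t * Real.cos φ + s * Real.sin φ) by ring,
    abs_mul, abs_mul, abs_of_pos hr0,
    show (r * Real.cos φ)^2 + (r * Real.sin φ)^2 = r^2 * (Real.sin φ ^2 + Real.cos φ^2) by ring,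
    Real.sin_sq_add_cos_sq, mul_one]
  ring

lemma corr (n m : EuclideanSpace ℝ (Fin 3)) (hn : ‖n‖ = 1) (hm : ‖m‖ = 1) :
    ∫ x : Metric.sphere (0 : EuclideanSpace ℝ (Fin 3)) 1, |⟪n, (x : EuclideanSpace ℝ (Fin 3))⟫| *
      |⟪m, (x : EuclideanSpace ℝ (Fin 3))⟫| ∂sphereProb = 2 / (3 * Real.pi) * Ff ⟪n, m⟫ := by
  obtain ⟨b, a, t, s, ha, hts, hnm, h1, h1'⟩ := exists_basis n m hn hm
  have h := integral_sphereProb (fun x => |⟪n, x⟫| * |⟪m, x⟫|) 2 (by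
    intro r hr x
    simp only [inner_smul_right, abs_mul, abs_of_pos hr]; ring)
  have h2 := integral_coords b (fun y => |y 0| * |t * y 0 + s * y 1|)
  have h3 := int3 (fun p => |p.1| * |t * p.1 + s * p.2|)
  have hF : Ff ⟪n, m⟫ = Ff t := by
    rw [hnm]
    rcases abs_eq (zero_le_one) |>.mp ha with h | h
    · rw [h, one_mul]
    · rw [h, neg_one_mul, Ff_neg]
  rw [hF]
  simp only [h1, h1', abs_mul, ha, one_mul] at h ⊢
  rw [h2, h3, int2_polar t s hts] at h
  have g3 : Real.Gamma (((2:ℕ):ℝ)/2+3/2) = 3/4 * Real.Gamma (1/2) := by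
    rw [show ((2:ℕ):ℝ)/2+3/2 = 1/2 + 1 + 1 by norm_num, Real.Gamma_add_one (by norm_num), Real.Gamma_add_one (by norm_num)]
    ring
  rw [add_div, g3] at h
  have hG : 0 < Real.Gamma (1/2) := Real.Gamma_pos_of_pos (by positivity)
  have hp := Real.pi_pos
  rw [div_mul_eq_mul_div, eq_div_iff (by positivity)]
  apply mul_right_cancel₀ hG.ne'
  linarith



abbrev E3 := EuclideanSpace ℝ (Fin 3)
abbrev S2 := Metric.sphere (0 : EuclideanSpace ℝ (Fin 3)) 1

lemma cont_int (f : S2 → ℝ) (hf : Continuous f) : Integrable f sphereProb :=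
  hf.integrable_of_hasCompactSupport (HasCompactSupport.of_compactSpace f)

lemma S2_norm (x : S2) : ‖(x : E3)‖ = 1 := by simp

lemma moment_even (n : E3) (hn : ‖n‖ = 1) (m : ℕ) :
    ∫ x : S2, ⟪n, (x : E3)⟫ ^ (2*m+2) ∂sphereProb = 1 / (2*m+3) := by
  have h := moment n hn (2*m+2)
  have he : Even (2*m+2) := ⟨m+1, by ring⟩
  simp only [he.pow_abs] at h
  rw [h]
  push_cast
  ring_nf

noncomputable def mon {k : ℕ} (x : E3) (s : Fin k → Fin 3) : ℝ := ∏ l, x (s l)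

lemma inner_pow_eq {k : ℕ} (x y : E3) : ⟪x, y⟫ ^ k = ∑ s : Fin k → Fin 3, mon x s * mon y s := by
  have h : ⟪x, y⟫ = ∑ i, x i * y i := by
    rw [PiLp.inner_apply]
    simp [mul_comm]
  rw [h, Fintype.sum_pow]
  simp only [mon, Finset.prod_mul_distrib]

lemma mon_cont {k : ℕ} (s : Fin k → Fin 3) : Continuous (fun x : S2 => mon (x : E3) s) := by
  unfold mon; fun_prop

lemma mon_pair (n : E3) (hn : ‖n‖ = 1) (m : ℕ) :
    ∑ s : Fin (2*m+2) → Fin 3, mon n s * ∫ x : S2, mon (x : E3) s ∂sphereProb = 1 / (2*m+3) := by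
  rw [← moment_even n hn m]
  simp only [inner_pow_eq]
  rw [integral_finsetSum]
  · simp only [integral_const_mul]
  · intro s _
    exact (cont_int _ (mon_cont s)).const_mul _

lemma A_nonneg {n : ℕ} (v : Fin n → E3) (hv : ∀ i, ‖v i‖ = 1) (α : Fin n → ℝ)
    (h1 : ∑ i, α i = 1) (m : ℕ) :
    0 ≤ (∑ i, ∑ j, α i * α j * ⟪v i, v j⟫ ^ (2*m+2)) - 1 / (2*m+3) := by
  set C : (Fin (2*m+2) → Fin 3) → ℝ := fun s => ∫ x : S2, mon (x : E3) s ∂sphereProb with hC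
  set M : (Fin (2*m+2) → Fin 3) → ℝ := fun s => ∑ i, α i * mon (v i) s with hM
  have e1 : ∑ s, M s ^ 2 = ∑ i, ∑ j, α i * α j * ⟪v i, v j⟫ ^ (2*m+2) := by
    simp only [inner_pow_eq, hM, sq, Finset.sum_mul_sum]
    rw [Finset.sum_comm]
    refine Finset.sum_congr rfl fun i _ => ?_
    rw [Finset.sum_comm]
    refine Finset.sum_congr rfl fun j _ => ?_
    rw [Finset.mul_sum]
    exact Finset.sum_congr rfl fun s _ => by ring
  have e2 : ∑ s, M s * C s = 1 / (2*m+3) := by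
    simp only [hM, Finset.sum_mul]
    rw [Finset.sum_comm]
    have : ∀ i, ∑ s, α i * mon (v i) s * C s = α i * (1 / (2*m+3)) := by
      intro i
      rw [← mon_pair (v i) (hv i) m, Finset.mul_sum]
      exact Finset.sum_congr rfl fun s _ => by ring
    simp only [this]
    rw [← Finset.sum_mul, h1, one_mul]
  have e3 : ∑ s, C s ^ 2 = 1 / (2*m+3) := by
    have : ∀ s, C s ^ 2 = ∫ x : S2, mon (x : E3) s * C s ∂sphereProb := by
      intro s
      rw [integral_mul_const, sq]
    simp only [this]
    rw [← integral_finsetSum]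
    · have : ∀ x : S2, ∑ s, mon (x : E3) s * C s = 1 / (2*m+3) := fun x => mon_pair x (S2_norm x) m
      simp only [this]
      simp
    · intro s _
      exact (cont_int _ (mon_cont s)).mul_const _
  have : 0 ≤ ∑ s, (M s - C s) ^ 2 := Finset.sum_nonneg fun s _ => sq_nonneg _
  have e4 : ∑ s, (M s - C s) ^ 2 = ∑ s, M s ^ 2 - 2 * ∑ s, M s * C s + ∑ s, C s ^ 2 := by
    rw [Finset.mul_sum, ← Finset.sum_sub_distrib, ← Finset.sum_add_distrib]
    exact Finset.sum_congr rfl fun s _ => by ring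
  rw [e4, e1, e2, e3] at this
  linarith

lemma A_lower {n : ℕ} (hn : 1 ≤ n) (v : Fin n → E3) (hv : ∀ i, ‖v i‖ = 1) (α : Fin n → ℝ)
    (h0 : ∀ i, 0 ≤ α i) (h1 : ∑ i, α i = 1) (m : ℕ) (hm : n ≤ m) :
    1 / (2 * n : ℝ) ≤ (∑ i, ∑ j, α i * α j * ⟪v i, v j⟫ ^ (2*m+2)) - 1 / (2*m+3) := by
  have hn' : (1:ℝ) ≤ n := by exact_mod_cast hn
  have hm' : (n:ℝ) ≤ m := by exact_mod_cast hm
  have he : Even (2*m+2) := ⟨m+1, by ring⟩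
  have e1 : ∑ i, α i ^ 2 ≤ ∑ i, ∑ j, α i * α j * ⟪v i, v j⟫ ^ (2*m+2) := by
    refine Finset.sum_le_sum fun i _ => ?_
    have := Finset.single_le_sum (f := fun j => α i * α j * ⟪v i, v j⟫ ^ (2*m+2)) (s := Finset.univ)
      (fun j _ => mul_nonneg (mul_nonneg (h0 i) (h0 j)) (he.pow_nonneg _)) (Finset.mem_univ i)
    refine le_trans (le_of_eq ?_) this
    rw [real_inner_self_eq_norm_sq, hv i]; ring
  have e2 := sq_sum_le_card_mul_sum_sq (s := Finset.univ) (f := α)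
  rw [h1] at e2
  simp only [Finset.card_univ, Fintype.card_fin] at e2
  have e3 : 1 / (n:ℝ) ≤ ∑ i, α i ^ 2 := by
    rw [div_le_iff₀ (by linarith)]; linarith
  have e4 : 1 / (2 * (m:ℝ) + 3) ≤ 1 / (2 * n) := by
    apply one_div_le_one_div_of_le <;> linarith
  have e5 : 1 / (n:ℝ) = 1 / (2 * n) + 1 / (2 * n) := by field_simp; norm_num
  linarith

lemma abs_inner_le (x y : E3) (hx : ‖x‖ = 1) (hy : ‖y‖ = 1) : |⟪x, y⟫| ≤ 1 := by
  have := abs_real_inner_le_norm x y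
  rwa [hx, hy, one_mul] at this

lemma moment_one (n : E3) (hn : ‖n‖ = 1) : ∫ x : S2, |⟪n, (x : E3)⟫| ∂sphereProb = 1/2 := by
  have h := moment n hn 1
  simp only [pow_one] at h
  rw [h]; norm_num

lemma mean_Ff (n : E3) (hn : ‖n‖ = 1) :
    ∫ y : S2, Ff ⟪n, (y : E3)⟫ ∂sphereProb = 3 * Real.pi / 8 := by
  have hp := Real.pi_pos
  have h1 : ∀ y : S2, Ff ⟪n, (y:E3)⟫ = 3 * Real.pi / 2 *
      ∫ x : S2, |⟪n, (x : E3)⟫| * |⟪(y:E3), (x : E3)⟫| ∂sphereProb := by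
    intro y
    rw [corr n y hn (S2_norm y)]
    field_simp
  simp only [h1]
  rw [integral_const_mul, integral_integral_swap]
  · have h2 : ∀ x : S2, ∫ y : S2, |⟪n, (x : E3)⟫| * |⟪(y:E3), (x : E3)⟫| ∂sphereProb =
        |⟪n, (x : E3)⟫| * (1/2) := by
      intro x
      rw [integral_const_mul, ← moment_one x (S2_norm x)]
      simp only [real_inner_comm]
    simp only [h2]
    rw [integral_mul_const, moment_one n hn]
    ring
  · apply Continuous.integrable_of_hasCompactSupport
    · unfold Function.uncurry
      fun_prop
    · exact HasCompactSupport.of_compactSpace _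

lemma mean_series : HasSum (fun m : ℕ => dco m * (1 / (2*m+3))) (3 * Real.pi / 8 - 1) := by
  set e : E3 := EuclideanSpace.single 0 1 with he
  have hn : ‖e‖ = 1 := by simp [he]
  have hc : ∀ m : ℕ, Continuous (fun y : S2 => dco m * ⟪e, (y:E3)⟫ ^ (2*m+2)) := fun m => by fun_prop
  have hi : ∀ m : ℕ, ∫ y : S2, dco m * ⟪e, (y:E3)⟫ ^ (2*m+2) ∂sphereProb = dco m * (1 / (2*m+3)) := by
    intro m
    rw [integral_const_mul, moment_even e hn]
  have key := hasSum_integral_of_summable_integral_norm (μ := sphereProb)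
    (F := fun (m : ℕ) (y : S2) => dco m * ⟪e, (y:E3)⟫ ^ (2*m+2))
    (fun m => cont_int _ (hc m)) ?_
  · simp only [hi] at key
    have : ∀ y : S2, ∑' m, dco m * ⟪e, (y:E3)⟫ ^ (2*m+2) = Ff ⟪e, (y:E3)⟫ - 1 := fun y =>
      (hasSum_Ff (abs_inner_le _ _ hn (S2_norm y))).tsum_eq
    simp only [this] at key
    rw [integral_sub, mean_Ff e hn] at key
    · simpa using key
    · apply cont_int
      have := Real.continuous_arcsin
      unfold Ff
      fun_prop
    · exact integrable_const _
  · have : ∀ m : ℕ, ∫ y : S2, ‖dco m * ⟪e, (y:E3)⟫ ^ (2*m+2)‖ ∂sphereProb = dco m * (1 / (2*m+3)) := by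
      intro m
      rw [← hi m]
      refine integral_congr_ae (Filter.Eventually.of_forall fun y => ?_)
      have he : Even (2*m+2) := ⟨m+1, by ring⟩
      exact Real.norm_of_nonneg (mul_nonneg (dco_pos m).le (he.pow_nonneg _))
    simp only [this]
    refine Summable.of_nonneg_of_le (fun m => ?_) (fun m => ?_) summable_dco
    · have := dco_pos m
      positivity
    · apply mul_le_of_le_one_right (dco_pos m).le
      rw [div_le_one (by positivity)]
      have : (0:ℝ) ≤ m := by positivity
      linarith

lemma L2_expand {n : ℕ} (v : Fin n → E3) (hv : ∀ i, ‖v i‖ = 1) (α : Fin n → ℝ)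
    (h1 : ∑ i, α i = 1) :
    ∫ x : S2, ((∑ i, α i * |⟪v i, (x : E3)⟫|) - 1 / 2) ^ 2 ∂sphereProb =
      2 / (3 * Real.pi) * (∑ i, ∑ j, α i * α j * Ff ⟪v i, v j⟫) - 1/4 := by
  have e : ∀ x : S2, ((∑ i, α i * |⟪v i, (x : E3)⟫|) - 1 / 2) ^ 2 =
      (∑ i, ∑ j, α i * α j * (|⟪v i, (x : E3)⟫| * |⟪v j, (x : E3)⟫|))
        - (∑ i, α i * |⟪v i, (x : E3)⟫|) + 1/4 := by
    intro x
    rw [sub_sq, sq, Finset.sum_mul_sum]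
    have : ∀ i j, α i * |⟪v i, (x : E3)⟫| * (α j * |⟪v j, (x : E3)⟫|) = 
      α i * α j * (|⟪v i, (x : E3)⟫| * |⟪v j, (x : E3)⟫|) := fun i j => by ring
    simp only [this]
    ring
  simp only [e]
  have i1 : ∫ x : S2, (∑ i, α i * |⟪v i, (x : E3)⟫|) ∂sphereProb = 1/2 := by
    rw [integral_finsetSum]
    · simp only [integral_const_mul, moment_one _ (hv _)]
      rw [← Finset.sum_mul, h1, one_mul]
    · intro i _
      exact cont_int _ (by fun_prop)
  have i2 : ∫ x : S2, (∑ i, ∑ j, α i * α j * (|⟪v i, (x : E3)⟫| * |⟪v j, (x : E3)⟫|)) ∂sphereProb =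
      2 / (3 * Real.pi) * (∑ i, ∑ j, α i * α j * Ff ⟪v i, v j⟫) := by
    rw [integral_finsetSum _ (fun i _ => cont_int _ (by fun_prop)), Finset.mul_sum]
    refine Finset.sum_congr rfl fun i _ => ?_
    rw [integral_finsetSum _ (fun i _ => cont_int _ (by fun_prop)), Finset.mul_sum]
    refine Finset.sum_congr rfl fun j _ => ?_
    rw [integral_const_mul, corr _ _ (hv i) (hv j)]
    ring
  rw [integral_add (cont_int _ (by fun_prop)) (integrable_const _),
    integral_sub (cont_int _ (by fun_prop)) (cont_int _ (by fun_prop)), i1, i2]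
  simp
  ring

lemma L2_hasSum {n : ℕ} (v : Fin n → E3) (hv : ∀ i, ‖v i‖ = 1) (α : Fin n → ℝ)
    (h1 : ∑ i, α i = 1) :
    HasSum (fun m : ℕ => dco m * ((∑ i, ∑ j, α i * α j * ⟪v i, v j⟫ ^ (2*m+2)) - 1 / (2*m+3)))
      (3 * Real.pi / 2 * ∫ x : S2, ((∑ i, α i * |⟪v i, (x : E3)⟫|) - 1 / 2) ^ 2 ∂sphereProb) := by
  have hp := Real.pi_pos
  rw [L2_expand v hv α h1]
  have s1 : HasSum (fun m : ℕ => ∑ i, ∑ j, α i * α j * (dco m * ⟪v i, v j⟫ ^ (2*m+2)))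
      (∑ i, ∑ j, α i * α j * (Ff ⟪v i, v j⟫ - 1)) :=
    hasSum_sum fun i _ => hasSum_sum fun j _ =>
      (hasSum_Ff (abs_inner_le _ _ (hv i) (hv j))).mul_left _
  have s2 := s1.sub mean_series
  have hone : ∑ i, ∑ j, α i * α j = 1 := by
    rw [← Finset.sum_mul_sum, h1, one_mul]
  have e1 : ∑ i, ∑ j, α i * α j * (Ff ⟪v i, v j⟫ - 1) = (∑ i, ∑ j, α i * α j * Ff ⟪v i, v j⟫) - 1 := by
    simp only [mul_sub, mul_one, Finset.sum_sub_distrib, hone]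
  rw [e1] at s2
  have e2 : 3 * Real.pi / 2 * (2 / (3 * Real.pi) * (∑ i, ∑ j, α i * α j * Ff ⟪v i, v j⟫) - 1/4) =
      (∑ i, ∑ j, α i * α j * Ff ⟪v i, v j⟫) - 1 - (3 * Real.pi / 8 - 1) := by
    field_simp
    ring
  rw [e2]
  refine s2.congr_fun ?_
  intro m
  rw [mul_sub, Finset.mul_sum]
  congr 1
  refine Finset.sum_congr rfl fun i _ => ?_
  rw [Finset.mul_sum]
  exact Finset.sum_congr rfl fun j _ => by ring

lemma dco_lower {n m : ℕ} (hn : 1 ≤ n) (h1 : n ≤ m) (h2 : m < 2 * n) :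
    1 / (64 * (n:ℝ)^2 * √n) ≤ dco m := by
  have hn' : (1:ℝ) ≤ n := by exact_mod_cast hn
  have hm' : (m:ℝ) + 1 ≤ 2 * n := by exact_mod_cast h2
  obtain ⟨k, rfl⟩ : ∃ k, m = k + 1 := ⟨m - 1, by lia⟩
  have hb := bco_sq k
  have hbp := bco_pos (k+1)
  push_cast at hm'
  have hs : 0 < √(n:ℝ) := Real.sqrt_pos.mpr (by linarith)
  have hsq : √(n:ℝ)^2 = n := Real.sq_sqrt (by linarith)
  have hb2 : 1 ≤ 4 * √(n:ℝ) * bco (k+1) := by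
    have : (1:ℝ)^2 ≤ (4 * √(n:ℝ) * bco (k+1))^2 := by
      rw [mul_pow, mul_pow, hsq]
      have : 0 ≤ bco (k+1)^2 := by positivity
      nlinarith
    exact (sq_le_sq₀ (by norm_num) (by positivity)).mp this
  unfold dco
  push_cast
  rw [div_le_div_iff₀ (by positivity) (by positivity), one_mul]
  have hk : (0:ℝ) ≤ k := by positivity
  calc (2 * ((k:ℝ)+1) + 1) * (2 * (k+1) + 2) ≤ (4 * n) * (4 * n) := by gcongr <;> linarith
    _ = 16 * (n:ℝ)^2 * 1 := by ring
    _ ≤ 16 * (n:ℝ)^2 * (4 * √(n:ℝ) * bco (k+1)) := by gcongr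
    _ = _ := by ring

lemma L2_lower {n : ℕ} (hn : 1 ≤ n) (v : Fin n → E3) (hv : ∀ i, ‖v i‖ = 1) (α : Fin n → ℝ)
    (h0 : ∀ i, 0 ≤ α i) (h1 : ∑ i, α i = 1) :
    1 / (128 * (n:ℝ)^2 * √n) ≤ 
      3 * Real.pi / 2 * ∫ x : S2, ((∑ i, α i * |⟪v i, (x : E3)⟫|) - 1 / 2) ^ 2 ∂sphereProb := by
  have hn' : (1:ℝ) ≤ n := by exact_mod_cast hn
  have hs : 0 < √(n:ℝ) := Real.sqrt_pos.mpr (by linarith)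
  refine le_trans ?_ (sum_le_hasSum (Finset.Ico n (2*n))
    (fun m _ => mul_nonneg (dco_pos m).le (A_nonneg v hv α h1 m)) (L2_hasSum v hv α h1))
  have : ∀ m ∈ Finset.Ico n (2*n), 1 / (64 * (n:ℝ)^2 * √n) * (1 / (2 * n)) ≤
      dco m * ((∑ i, ∑ j, α i * α j * ⟪v i, v j⟫ ^ (2*m+2)) - 1 / (2*m+3)) := by
    intro m hm
    rw [Finset.mem_Ico] at hm
    exact mul_le_mul (dco_lower hn hm.1 hm.2) (A_lower hn v hv α h0 h1 m hm.1) (by positivity) (dco_pos m).le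
  have h3 := Finset.card_nsmul_le_sum _ _ _ this
  refine le_trans (le_of_eq ?_) h3
  rw [Nat.card_Ico, nsmul_eq_mul, show 2 * n - n = n by lia]
  field_simp
  norm_num



/-- Bourgain–Lindenstrauss–Milman `L²` lower bound for zonotope approximation of the
ball in dimension 3: there is a constant `c > 0` such that for all `n ≥ 1` unit vectors
`nᵢ ∈ S²` and weights `αᵢ ≥ 0` summing to 1, the function `f(x) = Σᵢ αᵢ|⟨nᵢ, x⟩|` on
`S²` satisfies `‖f − 1/2‖_{L²(σ)} ≥ c·n^(−5/4)` for the normalized surface measure σ. -/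
theorem BLM_L2_lower_bound_dim3 :
    ∃ c : ℝ, 0 < c ∧ ∀ n : ℕ, 1 ≤ n →
      ∀ v : Fin n → EuclideanSpace ℝ (Fin 3), (∀ i, ‖v i‖ = 1) →
      ∀ α : Fin n → ℝ, (∀ i, 0 ≤ α i) → ∑ i, α i = 1 →
      c * (n : ℝ) ^ (-(5 / 4 : ℝ)) ≤
        Real.sqrt (∫ x : Metric.sphere (0 : EuclideanSpace ℝ (Fin 3)) 1,
          ((∑ i, α i * |⟪v i, (x : EuclideanSpace ℝ (Fin 3))⟫|) - 1 / 2) ^ 2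
            ∂sphereProb) := by
  have hp := Real.pi_pos
  refine ⟨√(1 / (192 * Real.pi)), by positivity, ?_⟩
  intro n hn v hv α h0 h1
  have hn' : (1:ℝ) ≤ n := by exact_mod_cast hn
  have hs : 0 < √(n:ℝ) := Real.sqrt_pos.mpr (by linarith)
  apply Real.le_sqrt_of_sq_le
  have h := L2_lower hn v hv α h0 h1
  rw [mul_pow, Real.sq_sqrt (by positivity), ← Real.rpow_natCast, ← Real.rpow_mul (by linarith)]
  have e : (n:ℝ) ^ (-(5/4:ℝ) * ((2:ℕ):ℝ)) = 1 / ((n:ℝ)^2 * √n) := by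
    rw [show (-(5/4:ℝ) * ((2:ℕ):ℝ)) = -(2 + 1/2) by norm_num, Real.rpow_neg (by linarith),
      Real.rpow_add (by linarith), ← Real.sqrt_eq_rpow, one_div]
    norm_num
  rw [e]
  set I := ∫ x : S2, ((∑ i, α i * |⟪v i, (x : E3)⟫|) - 1 / 2) ^ 2 ∂sphereProb with hI
  have h2 : 1 / (192 * Real.pi) * (1 / ((n:ℝ)^2 * √n)) =
      2 / (3 * Real.pi) * (1 / (128 * (n:ℝ)^2 * √n)) := by
    field_simp
    norm_num
  rw [h2]
  calc _ ≤ 2 / (3 * Real.pi) * (3 * Real.pi / 2 * I) := by gcongr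
    _ = I := by field_simp
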